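/- arXiv:0806.1698 — 12 statements merged into one kernel-verified Lean document; each statement's English description precedes it below -/
import Mathlib

section
/- Let n be a real number with n ≠ -1, let f : ℝ → ℝ, and let u : ℝ × ℝ → ℝ be a twice continuously differentiable positive function satisfying the diffusion equation f(x)·u_t = (u^n·u_x)_x on an open set Ω ⊆ ℝ². Then the pair F = x·f(x)·u, G = -x·u^n·u_x + u^{n+1}/(n+1) is a conserved vector on Ω, i.e. ∂_t(x·f(x)·u) + ∂_x(-x·u^n·u_x + u^{n+1}/(n+1)) = 0 at every point of Ω. -/
/-- Partial derivative with respect to the first (time) variable. -/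
noncomputable def dt (u : ℝ × ℝ → ℝ) (p : ℝ × ℝ) : ℝ := deriv (fun s => u (s, p.2)) p.1

/-- Partial derivative with respect to the second (space) variable. -/
noncomputable def dx (u : ℝ × ℝ → ℝ) (p : ℝ × ℝ) : ℝ := deriv (fun y => u (p.1, y)) p.2

/-- For `n ≠ -1`, if `u > 0` solves `f(x) u_t = (u^n u_x)_x` on an open set `Ω`, then
`(x f(x) u, -x u^n u_x + u^(n+1)/(n+1))` is a conserved vector on `Ω`. -/
theorem conserved_vector_char_x (n : ℝ) (hn : n ≠ -1) (f : ℝ → ℝ) (u : ℝ × ℝ → ℝ)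
    (Ω : Set (ℝ × ℝ)) (hΩ : IsOpen Ω)
    (hu : ContDiffOn ℝ 2 u Ω) (hupos : ∀ p ∈ Ω, 0 < u p)
    (heq : ∀ p ∈ Ω, f p.2 * dt u p = dx (fun q => u q ^ n * dx u q) p) :
    ∀ p ∈ Ω,
      dt (fun q => q.2 * f q.2 * u q) p
        + dx (fun q => -(q.2 * u q ^ n * dx u q) + u q ^ (n + 1) / (n + 1)) p = 0 := by
  rintro ⟨t, x⟩ hp
  have hv : ContDiffAt ℝ 2 (fun y => u (t, y)) x :=
    (hu.contDiffAt (hΩ.mem_nhds hp)).comp x (by fun_prop)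
  have hv1 : DifferentiableAt ℝ (fun y => u (t, y)) x := hv.differentiableAt (by norm_num)
  have hv2 : DifferentiableAt ℝ (fun y => dx u (t, y)) x :=
    ((hv.fderiv_right (m := 1) (by norm_num)).differentiableAt (by norm_num)).clm_apply
      (differentiableAt_const (1 : ℝ))
  have hpos : 0 < u (t, x) := hupos _ hp
  have hn1 : n + 1 ≠ 0 := fun h => hn (by linarith)
  have hflux : HasDerivAt (fun y => u (t, y) ^ n * dx u (t, y))
      (dx (fun q => u q ^ n * dx u q) (t, x)) x :=
    ((hv1.rpow_const (Or.inl hpos.ne')).mul hv2).hasDerivAt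
  have hpow := (hv1.hasDerivAt.rpow_const (p := n + 1) (Or.inl hpos.ne')).div_const (n + 1)
  have hG : dx (fun q => -(q.2 * u q ^ n * dx u q) + u q ^ (n + 1) / (n + 1)) (t, x)
      = -(x * dx (fun q => u q ^ n * dx u q) (t, x)) := by
    have h := ((hasDerivAt_id x).mul hflux).neg.add hpow
    refine (HasDerivAt.deriv (h.congr_of_eventuallyEq (.of_forall fun y => ?_))).trans ?_
    · simp [mul_assoc]
    · simp only [id, add_sub_cancel_right, dx]
      field_simp
      ring
  have hF : dt (fun q => q.2 * f q.2 * u q) (t, x) = x * f x * dt u (t, x) :=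
    deriv_const_mul_field (v := fun s => u (s, x)) (x * f x)
  have hpde := heq _ hp
  rw [hF, hG, ← hpde]
  ring
end

section
/- Let n ≠ -1, n ≠ 0 be real, let δ₁,…,δ₇ be real constants with δ₁·δ₇ ≠ 0 and δ₃δ₆ - δ₄δ₅ = 1, and let f : ℝ → ℝ. Suppose u : ℝ × ℝ → ℝ is a twice continuously differentiable positive solution of f(x)·u_t = (u^n·u_x)_x on the region where δ₅x + δ₆ > 0. Define the transformed variables t̃ = δ₁t + δ₂, x̃ = (δ₃x + δ₄)/(δ₅x + δ₆), and define ũ(t̃, x̃) = δ₇·(δ₅x + δ₆)^{-1/(n+1)}·u(t,x) and f̃(x̃) = δ₁·δ₇^n·(δ₅x + δ₆)^{(3n+4)/(n+1)}·f(x), where x = (δ₆x̃ - δ₄)/(δ₃ - δ₅x̃) inverts the Möbius map. Then ũ is a solution of f̃(x̃)·ũ_{t̃} = (ũ^n·ũ_{x̃})_{x̃} on the corresponding transformed domain. (This is the generalized equivalence transformation of the class f(x)u_t = (u^n u_x)_x for n ≠ -1.) -/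
theorem Real.mul_rpow_of_nonneg_right (x : ℝ) {y : ℝ} (hy : 0 ≤ y) (n : ℝ) :
    (x * y) ^ n = x ^ n * y ^ n := by
  rcases le_or_gt 0 x with hx | hx
  · exact Real.mul_rpow hx hy
  rcases hy.eq_or_lt with rfl | hy
  · rcases eq_or_ne n 0 with rfl | hn
    · simp
    · simp [Real.zero_rpow hn]
  rw [Real.rpow_def_of_neg (mul_neg_of_neg_of_pos hx hy), Real.rpow_def_of_neg hx,
    Real.rpow_def_of_pos hy, Real.log_mul hx.ne hy.ne', add_mul, Real.exp_add]
  ring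

/-- The inverse of a Möbius map of determinant one has derivative `1 / (δ₃ - δ₅ y) ^ 2`. -/
theorem hasDerivAt_moebius_inv {δ₃ δ₄ δ₅ δ₆ y : ℝ} (hdet : δ₃ * δ₆ - δ₄ * δ₅ = 1)
    (hy : 0 < δ₃ - δ₅ * y) :
    HasDerivAt (fun y => (δ₆ * y - δ₄) / (δ₃ - δ₅ * y)) (1 / (δ₃ - δ₅ * y) ^ 2) y := by
  have h := (((hasDerivAt_id y).const_mul δ₆).sub_const δ₄).div
    (((hasDerivAt_id y).const_mul δ₅).const_sub δ₃) hy.ne'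
  refine h.congr_deriv ?_
  congr 1
  simp only [id]
  linear_combination hdet

theorem moebius_inv_denom {δ₃ δ₄ δ₅ δ₆ y : ℝ} (hdet : δ₃ * δ₆ - δ₄ * δ₅ = 1)
    (hy : 0 < δ₃ - δ₅ * y) :
    δ₅ * ((δ₆ * y - δ₄) / (δ₃ - δ₅ * y)) + δ₆ = (δ₃ - δ₅ * y)⁻¹ := by
  have := hy.ne'
  field_simp
  linear_combination hdet

theorem moebius_moebius_inv {δ₃ δ₄ δ₅ δ₆ y : ℝ} (hdet : δ₃ * δ₆ - δ₄ * δ₅ = 1)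
    (hy : 0 < δ₃ - δ₅ * y) :
    (δ₃ * ((δ₆ * y - δ₄) / (δ₃ - δ₅ * y)) + δ₄) /
      (δ₅ * ((δ₆ * y - δ₄) / (δ₃ - δ₅ * y)) + δ₆) = y := by
  rw [moebius_inv_denom hdet hy, div_inv_eq_mul, add_mul, mul_assoc, div_mul_cancel₀ _ hy.ne']
  linear_combination y * hdet

/-- The flux `h ^ n * h'` of the transformed function, in terms of the flux of `g`. -/
theorem moebius_flux {n δ₃ δ₄ δ₅ δ₆ δ₇ y : ℝ} (hn1 : n ≠ -1)
    (hdet : δ₃ * δ₆ - δ₄ * δ₅ = 1) {g h : ℝ → ℝ}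
    (hg : ∀ x, 0 < δ₅ * x + δ₆ → DifferentiableAt ℝ g x)
    (hpos : ∀ x, 0 < δ₅ * x + δ₆ → 0 < g x)
    (hh : ∀ y, 0 < δ₃ - δ₅ * y →
      h y = δ₇ * (δ₃ - δ₅ * y) ^ (1 / (n + 1)) * g ((δ₆ * y - δ₄) / (δ₃ - δ₅ * y)))
    (hy : 0 < δ₃ - δ₅ * y) :
    h y ^ n * deriv h y = δ₇ ^ n * δ₇ *
      ((δ₃ - δ₅ * y)⁻¹ * (g ((δ₆ * y - δ₄) / (δ₃ - δ₅ * y)) ^ n *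
          deriv g ((δ₆ * y - δ₄) / (δ₃ - δ₅ * y))) -
        1 / (n + 1) * δ₅ * g ((δ₆ * y - δ₄) / (δ₃ - δ₅ * y)) ^ (n + 1)) := by
  have hn : n + 1 ≠ 0 := fun h => hn1 (by linarith)
  have hw : 0 < δ₅ * ((δ₆ * y - δ₄) / (δ₃ - δ₅ * y)) + δ₆ := by
    rw [moebius_inv_denom hdet hy]; positivity
  have hs : HasDerivAt (fun y => δ₃ - δ₅ * y) (-δ₅) y := by
    simpa using ((hasDerivAt_id y).const_mul δ₅).const_sub δ₃
  have hev : h =ᶠ[nhds y] fun y =>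
      δ₇ * (δ₃ - δ₅ * y) ^ (1 / (n + 1)) * g ((δ₆ * y - δ₄) / (δ₃ - δ₅ * y)) :=
    (hs.continuousAt.eventually_const_lt hy).mono fun z hz => hh z hz
  have hd := (((hs.rpow_const (p := 1 / (n + 1)) (Or.inl hy.ne')).const_mul δ₇).mul
    ((hg _ hw).hasDerivAt.comp y (hasDerivAt_moebius_inv hdet hy))).congr_of_eventuallyEq hev
  rw [hd.deriv, hh y hy]
  have hgx := hpos _ hw
  simp only [Function.comp_apply]
  generalize (δ₆ * y - δ₄) / (δ₃ - δ₅ * y) = x at *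
  generalize δ₃ - δ₅ * y = s at *
  have hsa : (s ^ (1 / (n + 1))) ^ n * s ^ (1 / (n + 1)) = s := by
    rw [← Real.rpow_mul hy.le, ← Real.rpow_add hy]
    conv_rhs => rw [← Real.rpow_one s]
    congr 1
    field_simp
  rw [mul_assoc δ₇, Real.mul_rpow_of_nonneg_right _ (by positivity),
    Real.mul_rpow (by positivity) hgx.le, Real.rpow_sub_one hy.ne', Real.rpow_add_one hgx.ne']
  generalize s ^ (1 / (n + 1)) = A at *
  generalize A ^ n = B at *
  field_simp
  linear_combination (δ₇ ^ n * δ₇ * ((n + 1) * deriv g x - δ₅ * s * g x)) * hsa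

theorem deriv_moebius_flux {n δ₃ δ₄ δ₅ δ₆ δ₇ y : ℝ} (hn1 : n ≠ -1)
    (hdet : δ₃ * δ₆ - δ₄ * δ₅ = 1) {g h : ℝ → ℝ}
    (hg : ContDiffOn ℝ 2 g {x | 0 < δ₅ * x + δ₆})
    (hpos : ∀ x, 0 < δ₅ * x + δ₆ → 0 < g x)
    (hh : ∀ y, 0 < δ₃ - δ₅ * y →
      h y = δ₇ * (δ₃ - δ₅ * y) ^ (1 / (n + 1)) * g ((δ₆ * y - δ₄) / (δ₃ - δ₅ * y)))
    (hy : 0 < δ₃ - δ₅ * y) :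
    deriv (fun z => h z ^ n * deriv h z) y = δ₇ ^ n * δ₇ * ((δ₃ - δ₅ * y)⁻¹ ^ 3 *
      deriv (fun x => g x ^ n * deriv g x) ((δ₆ * y - δ₄) / (δ₃ - δ₅ * y))) := by
  have hn : n + 1 ≠ 0 := fun h => hn1 (by linarith)
  have hopen : IsOpen {x : ℝ | 0 < δ₅ * x + δ₆} := isOpen_lt (by fun_prop) (by fun_prop)
  have hgd : ∀ x, 0 < δ₅ * x + δ₆ → DifferentiableAt ℝ g x := fun x hx =>
    (hg.differentiableOn (by norm_num)).differentiableAt (hopen.mem_nhds hx)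
  have hw : 0 < δ₅ * ((δ₆ * y - δ₄) / (δ₃ - δ₅ * y)) + δ₆ := by
    rw [moebius_inv_denom hdet hy]; positivity
  have hgd' : DifferentiableAt ℝ (deriv g) ((δ₆ * y - δ₄) / (δ₃ - δ₅ * y)) :=
    ((hg.deriv_of_isOpen hopen (m := 1) (by norm_num)).differentiableOn
      (by norm_num)).differentiableAt (hopen.mem_nhds hw)
  have hs : HasDerivAt (fun y => δ₃ - δ₅ * y) (-δ₅) y := by
    simpa using ((hasDerivAt_id y).const_mul δ₅).const_sub δ₃
  have hev := (hs.continuousAt.eventually_const_lt hy).mono fun z hz =>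
    moebius_flux hn1 hdet hgd hpos hh hz
  have hX := hasDerivAt_moebius_inv hdet hy
  have hgx := hpos _ hw
  have hflux : DifferentiableAt ℝ (fun x => g x ^ n * deriv g x)
      ((δ₆ * y - δ₄) / (δ₃ - δ₅ * y)) :=
    ((hgd _ hw).rpow_const (Or.inl hgx.ne')).mul hgd'
  have hd := ((((hs.inv hy.ne').mul (hflux.hasDerivAt.comp y hX)).sub
    ((((hgd _ hw).hasDerivAt.comp y hX).rpow_const (p := n + 1) (Or.inl hgx.ne')).const_mul
      (1 / (n + 1) * δ₅))).const_mul (δ₇ ^ n * δ₇)).congr_of_eventuallyEq hev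
  rw [hd.deriv]
  simp only [Function.comp_apply, Pi.inv_apply, add_sub_cancel_right]
  have := hy.ne'
  field_simp
  ring

/-- The generalized equivalence transformation of the class `f(x) u_t = (u^n u_x)_x`
for `n ≠ -1`: the Möbius change of variables `t̃ = δ₁ t + δ₂`,
`x̃ = (δ₃ x + δ₄)/(δ₅ x + δ₆)`, `ũ = δ₇ (δ₅ x + δ₆)^(-1/(n+1)) u`,
`f̃ = δ₁ δ₇^n (δ₅ x + δ₆)^((3n+4)/(n+1)) f` maps solutions to solutions. -/
theorem generalized_equivalence_transformation (n : ℝ) (hn1 : n ≠ -1) (hn0 : n ≠ 0)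
    (δ₁ δ₂ δ₃ δ₄ δ₅ δ₆ δ₇ : ℝ) (hδ : δ₁ * δ₇ ≠ 0) (hdet : δ₃ * δ₆ - δ₄ * δ₅ = 1)
    (f : ℝ → ℝ) (u : ℝ × ℝ → ℝ)
    (hu : ContDiffOn ℝ 2 u {p : ℝ × ℝ | 0 < δ₅ * p.2 + δ₆})
    (hupos : ∀ p : ℝ × ℝ, 0 < δ₅ * p.2 + δ₆ → 0 < u p)
    (heq : ∀ p : ℝ × ℝ, 0 < δ₅ * p.2 + δ₆ →
      f p.2 * dt u p = dx (fun q => u q ^ n * dx u q) p)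
    (U : ℝ × ℝ → ℝ) (F : ℝ → ℝ)
    (hU : ∀ t x : ℝ, 0 < δ₅ * x + δ₆ →
      U (δ₁ * t + δ₂, (δ₃ * x + δ₄) / (δ₅ * x + δ₆))
        = δ₇ * (δ₅ * x + δ₆) ^ (-(1 / (n + 1))) * u (t, x))
    (hF : ∀ x : ℝ, 0 < δ₅ * x + δ₆ →
      F ((δ₃ * x + δ₄) / (δ₅ * x + δ₆))
        = δ₁ * δ₇ ^ n * (δ₅ * x + δ₆) ^ ((3 * n + 4) / (n + 1)) * f x) :
    ∀ p : ℝ × ℝ, 0 < δ₃ - δ₅ * p.2 →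
      F p.2 * dt U p = dx (fun q => U q ^ n * dx U q) p := by
  intro p hp
  have hδ₁ : δ₁ ≠ 0 := left_ne_zero_of_mul hδ
  have hn : n + 1 ≠ 0 := fun h => hn1 (by linarith)
  have hopen : IsOpen {p : ℝ × ℝ | 0 < δ₅ * p.2 + δ₆} := isOpen_lt (by fun_prop) (by fun_prop)
  have hU' : ∀ s y : ℝ, 0 < δ₃ - δ₅ * y → U (s, y) = δ₇ * (δ₃ - δ₅ * y) ^ (1 / (n + 1)) *
      u ((s - δ₂) / δ₁, (δ₆ * y - δ₄) / (δ₃ - δ₅ * y)) := by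
    intro s y hy
    have hw := moebius_inv_denom hdet hy
    have h := hU ((s - δ₂) / δ₁) _ (hw ▸ inv_pos.2 hy)
    rwa [moebius_moebius_inv hdet hy, hw, Real.inv_rpow hy.le, ← Real.rpow_neg hy.le, neg_neg,
      mul_div_cancel₀ _ hδ₁, sub_add_cancel] at h
  obtain ⟨t, y⟩ := p
  simp only at hp
  have hw := moebius_inv_denom hdet hp
  have hwpos : 0 < δ₅ * ((δ₆ * y - δ₄) / (δ₃ - δ₅ * y)) + δ₆ := hw ▸ inv_pos.2 hp
  have hflux := deriv_moebius_flux (δ₇ := δ₇) (g := fun x => u ((t - δ₂) / δ₁, x))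
    (h := fun z => U (t, z)) hn1 hdet
    (hu.comp (by fun_prop) fun x hx => hx) (fun x hx => hupos _ hx) (fun z hz => hU' t z hz) hp
  have htime : dt U (t, y) = δ₇ * (δ₃ - δ₅ * y) ^ (1 / (n + 1)) *
      (dt u ((t - δ₂) / δ₁, (δ₆ * y - δ₄) / (δ₃ - δ₅ * y)) * (1 / δ₁)) := by
    have hut : DifferentiableAt ℝ (fun s => u (s, (δ₆ * y - δ₄) / (δ₃ - δ₅ * y)))
        ((t - δ₂) / δ₁) :=
      ((hu.differentiableOn (by norm_num)).differentiableAt (hopen.mem_nhds hwpos)).comp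
        ((t - δ₂) / δ₁) (by fun_prop)
    have hd := (hut.hasDerivAt.comp t (((hasDerivAt_id t).sub_const δ₂).div_const δ₁)).const_mul
      (δ₇ * (δ₃ - δ₅ * y) ^ (1 / (n + 1)))
    unfold dt
    rw [← hd.deriv]
    exact congrArg (fun k => deriv k t) (funext fun s => hU' s y hp)
  have hFy := hF _ hwpos
  rw [moebius_moebius_inv hdet hp, hw] at hFy
  have hpde := heq ((t - δ₂) / δ₁, (δ₆ * y - δ₄) / (δ₃ - δ₅ * y)) hwpos
  have hexp : (δ₃ - δ₅ * y)⁻¹ ^ ((3 * n + 4) / (n + 1)) * (δ₃ - δ₅ * y) ^ (1 / (n + 1)) =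
      (δ₃ - δ₅ * y)⁻¹ ^ 3 := by
    rw [← inv_inv ((δ₃ - δ₅ * y) ^ (1 / (n + 1))), ← Real.inv_rpow hp.le,
      ← Real.rpow_neg (inv_pos.2 hp).le, ← Real.rpow_add (inv_pos.2 hp), ← Real.rpow_natCast]
    congr 1
    field_simp
    push_cast
    ring
  refine Eq.trans ?_ hflux.symm
  change _ = δ₇ ^ n * δ₇ * ((δ₃ - δ₅ * y)⁻¹ ^ 3 *
    dx (fun q => u q ^ n * dx u q) ((t - δ₂) / δ₁, (δ₆ * y - δ₄) / (δ₃ - δ₅ * y)))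
  rw [← hpde, htime, ← hexp]
  simp only [hFy]
  field_simp
end

section
/- Let δ₁,…,δ₆ be real constants with δ₁·δ₃·δ₅ ≠ 0, let f : ℝ → ℝ, and suppose u : ℝ × ℝ → ℝ is a twice continuously differentiable positive solution of f(x)·u_t = (u^{-1}·u_x)_x on an open set. Define t̃ = δ₁t + δ₂, x̃ = δ₃x + δ₄, ũ(t̃, x̃) = δ₅·e^{δ₆x}·u(t,x), and f̃(x̃) = δ₁·δ₃^{-2}·δ₅^{-1}·e^{-δ₆x}·f(x) with x = (x̃ - δ₄)/δ₃. Then ũ solves f̃(x̃)·ũ_{t̃} = (ũ^{-1}·ũ_{x̃})_{x̃} on the transformed domain. (This is the generalized equivalence transformation of the class f(x)u_t = (u^n u_x)_x in the singular case n = -1.) -/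
theorem deriv_comp_affine (g : ℝ → ℝ) (a b x : ℝ) :
    deriv (fun y => g (a * y + b)) x = a * deriv g (a * x + b) := by
  rw [deriv_comp_mul_left a (fun z => g (z + b)) x, deriv_comp_add_const, smul_eq_mul]

theorem dt_comp_affine (U : ℝ × ℝ → ℝ) (a b t z : ℝ) :
    deriv (fun s => U (a * s + b, z)) t = a * dt U (a * t + b, z) :=
  deriv_comp_affine (fun s => U (s, z)) a b t

theorem dx_comp_affine (U : ℝ × ℝ → ℝ) (a b s x : ℝ) :
    deriv (fun y => U (s, a * y + b)) x = a * dx U (s, a * x + b) :=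
  deriv_comp_affine (fun y => U (s, y)) a b x

theorem deriv_const_mul_exp_mul {v : ℝ → ℝ} {x : ℝ} (c k : ℝ) (hv : DifferentiableAt ℝ v x) :
    deriv (fun y => c * Real.exp (k * y) * v y) x =
      c * Real.exp (k * x) * (k * v x + deriv v x) := by
  have hexp : HasDerivAt (fun y => c * Real.exp (k * y)) (c * (Real.exp (k * x) * (k * 1))) x :=
    (((hasDerivAt_id x).const_mul k).exp).const_mul c
  rw [(hexp.fun_mul hv.hasDerivAt).deriv]
  ring

/-- The generalized equivalence transformation of the class `f(x) u_t = (u^n u_x)_x`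
in the singular case `n = -1`: `t̃ = δ₁ t + δ₂`, `x̃ = δ₃ x + δ₄`,
`ũ = δ₅ e^(δ₆ x) u`, `f̃ = δ₁ δ₃⁻² δ₅⁻¹ e^(-δ₆ x) f` maps solutions to solutions. -/
theorem generalized_equivalence_transformation_n_eq_neg_one
    (δ₁ δ₂ δ₃ δ₄ δ₅ δ₆ : ℝ) (hδ : δ₁ * δ₃ * δ₅ ≠ 0)
    (f : ℝ → ℝ) (u : ℝ × ℝ → ℝ) (Ω : Set (ℝ × ℝ)) (hΩ : IsOpen Ω)
    (hu : ContDiffOn ℝ 2 u Ω) (hupos : ∀ p ∈ Ω, 0 < u p)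
    (heq : ∀ p ∈ Ω, f p.2 * dt u p = dx (fun q => (u q)⁻¹ * dx u q) p)
    (U : ℝ × ℝ → ℝ) (F : ℝ → ℝ)
    (hU : ∀ t x : ℝ, U (δ₁ * t + δ₂, δ₃ * x + δ₄) = δ₅ * Real.exp (δ₆ * x) * u (t, x))
    (hF : ∀ x : ℝ, F (δ₃ * x + δ₄) = δ₁ * (δ₃ ^ 2)⁻¹ * δ₅⁻¹ * Real.exp (-(δ₆ * x)) * f x) :
    ∀ p ∈ (fun q : ℝ × ℝ => (δ₁ * q.1 + δ₂, δ₃ * q.2 + δ₄)) '' Ω,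
      F p.2 * dt U p = dx (fun q => (U q)⁻¹ * dx U q) p := by
  have h₁ : δ₁ ≠ 0 := left_ne_zero_of_mul (left_ne_zero_of_mul hδ)
  have h₃ : δ₃ ≠ 0 := right_ne_zero_of_mul (left_ne_zero_of_mul hδ)
  have h₅ : δ₅ ≠ 0 := right_ne_zero_of_mul hδ
  rintro _ ⟨⟨t, x⟩, hp, rfl⟩
  have hdt : δ₁ * dt U (δ₁ * t + δ₂, δ₃ * x + δ₄) = δ₅ * Real.exp (δ₆ * x) * dt u (t, x) := by
    rw [← dt_comp_affine]
    simp only [hU, deriv_const_mul_field, dt]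
  have hflux : ∀ y, (t, y) ∈ Ω →
      (U (δ₁ * t + δ₂, δ₃ * y + δ₄))⁻¹ * dx U (δ₁ * t + δ₂, δ₃ * y + δ₄) =
        δ₃⁻¹ * (δ₆ + (u (t, y))⁻¹ * dx u (t, y)) := by
    intro y hy
    have hdiff : DifferentiableAt ℝ (fun z => u (t, z)) y :=
      ((hu.contDiffAt (hΩ.mem_nhds hy)).differentiableAt two_ne_zero).comp y
        ((differentiableAt_const t).prodMk differentiableAt_id)
    have hdx : δ₃ * dx U (δ₁ * t + δ₂, δ₃ * y + δ₄) =
        δ₅ * Real.exp (δ₆ * y) * (δ₆ * u (t, y) + dx u (t, y)) := by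
      rw [← dx_comp_affine]
      simp only [hU]
      exact deriv_const_mul_exp_mul δ₅ δ₆ hdiff
    have hne : u (t, y) ≠ 0 := (hupos _ hy).ne'
    have hexp := Real.exp_ne_zero (δ₆ * y)
    rw [hU, eq_div_of_mul_eq h₃ ((mul_comm _ _).trans hdx)]
    field_simp
  have hnear : ∀ᶠ y in nhds x, (t, y) ∈ Ω :=
    (Continuous.prodMk_right t).continuousAt.eventually (hΩ.mem_nhds hp)
  have hdiv : δ₃ * dx (fun q => (U q)⁻¹ * dx U q) (δ₁ * t + δ₂, δ₃ * x + δ₄) =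
      δ₃⁻¹ * dx (fun q => (u q)⁻¹ * dx u q) (t, x) := by
    rw [← dx_comp_affine, Filter.EventuallyEq.deriv_eq (hnear.mono hflux),
      deriv_const_mul_field, deriv_const_add]
    rfl
  have hexp := Real.exp_ne_zero (δ₆ * x)
  rw [← heq _ hp] at hdiv
  dsimp only at hdiv ⊢
  rw [hF, Real.exp_neg, eq_div_of_mul_eq h₁ ((mul_comm _ _).trans hdt),
    eq_div_of_mul_eq h₃ ((mul_comm _ _).trans hdiv)]
  field_simp
end

section
/- Let n ≠ 0 be real, let f, g : I → ℝ be continuous on an open interval I with g > 0, and let X : I → ℝ satisfy X'(x) = 1/g(x), so that X is a diffeomorphism of I onto an interval J. Suppose u : ℝ × I → ℝ is a twice continuously differentiable positive solution of f(x)·u_t = (g(x)·u^n·u_x)_x. Define ũ : ℝ × J → ℝ by ũ(t, X(x)) = u(t, x) and f̃ : J → ℝ by f̃(X(x)) = g(x)·f(x). Then ũ solves f̃(x̃)·ũ_t = (ũ^n·ũ_{x̃})_{x̃} on ℝ × J. Hence every equation f(x)u_t = (g(x)u^n u_x)_x is reduced by the point transformation t̃ = t, x̃ = ∫dx/g(x),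 ũ = u to an equation of the same form with g̃ ≡ 1. -/
/-- Change of variables for `deriv` under a local diffeomorphism, with no differentiability
assumption on the function being transformed. -/
theorem deriv_eq_inv_mul_deriv_of_comp_eventuallyEq {X V h : ℝ → ℝ} {a x : ℝ}
    (hX : HasStrictDerivAt X a x) (ha : a ≠ 0) (hV : V ∘ X =ᶠ[nhds x] h) :
    deriv V (X x) = a⁻¹ * deriv h x := by
  by_cases hd : DifferentiableAt ℝ h x
  · set Y := hX.localInverse X a x ha with hY
    have hYd : HasStrictDerivAt Y a⁻¹ (X x) := hX.to_localInverse ha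
    have hYx : Y (X x) = x := (hX.eventually_left_inverse ha).self_of_nhds
    have hright : ∀ᶠ y in nhds (X x), X (Y y) = y := hX.eventually_right_inverse ha
    have htend : Filter.Tendsto Y (nhds (X x)) (nhds x) := by
      simpa only [ContinuousAt, hYx] using hYd.hasDerivAt.continuousAt
    have hVY : V =ᶠ[nhds (X x)] h ∘ Y := by
      filter_upwards [hright, htend.eventually hV] with y h₁ h₂
      simpa only [Function.comp_apply, h₁] using h₂
    have hcomp : HasDerivAt (h ∘ Y) (deriv h x * a⁻¹) (X x) :=
      HasDerivAt.comp (X x) (by rw [hYx]; exact hd.hasDerivAt) hYd.hasDerivAt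
    rw [hVY.deriv_eq, hcomp.deriv, mul_comm]
  · have hVd : ¬ DifferentiableAt ℝ V (X x) := fun hVd =>
      hd ((hVd.comp x hX.hasDerivAt.differentiableAt).congr_of_eventuallyEq hV.symm)
    rw [deriv_zero_of_not_differentiableAt hd, deriv_zero_of_not_differentiableAt hVd, mul_zero]

/-- The point transformation `t̃ = t`, `x̃ = X(x)` with `X' = 1/g`, `ũ = u` reduces
every equation `f(x) u_t = (g(x) u^n u_x)_x` to `f̃(x̃) ũ_t = (ũ^n ũ_x̃)_x̃` with
`f̃(X(x)) = g(x) f(x)`, i.e. to the gauge `g̃ ≡ 1`. -/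
theorem gauge_g_to_one (n : ℝ) (hn : n ≠ 0)
    (I : Set ℝ) (hIopen : IsOpen I) (hIconn : I.OrdConnected)
    (f g : ℝ → ℝ) (hf : ContinuousOn f I) (hg : ContinuousOn g I)
    (hgpos : ∀ x ∈ I, 0 < g x)
    (X : ℝ → ℝ) (hX : ∀ x ∈ I, HasDerivAt X (1 / g x) x)
    (u : ℝ × ℝ → ℝ)
    (hu : ContDiffOn ℝ 2 u (Set.univ ×ˢ I))
    (hupos : ∀ t : ℝ, ∀ x ∈ I, 0 < u (t, x))
    (heq : ∀ t : ℝ, ∀ x ∈ I,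
      f x * dt u (t, x) = dx (fun q => g q.2 * u q ^ n * dx u q) (t, x))
    (U : ℝ × ℝ → ℝ) (F : ℝ → ℝ)
    (hU : ∀ t : ℝ, ∀ x ∈ I, U (t, X x) = u (t, x))
    (hF : ∀ x ∈ I, F (X x) = g x * f x) :
    ∀ t : ℝ, ∀ y ∈ X '' I,
      F y * dt U (t, y) = dx (fun q => U q ^ n * dx U q) (t, y) := by
  rintro t _ ⟨x, hx, rfl⟩
  have hstrict : ∀ z ∈ I, HasStrictDerivAt X (1 / g z) z := fun z hz =>
    hasStrictDerivAt_of_hasDerivAt_of_continuousAt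
      (Filter.eventually_of_mem (hIopen.mem_nhds hz) hX)
      (continuousAt_const.div (hg.continuousAt (hIopen.mem_nhds hz)) (hgpos z hz).ne')
  have hne : ∀ z ∈ I, 1 / g z ≠ 0 := fun z hz => one_div_ne_zero (hgpos z hz).ne'
  have hdx : ∀ z ∈ I, dx U (t, X z) = g z * dx u (t, z) := fun z hz => by
    have h := deriv_eq_inv_mul_deriv_of_comp_eventuallyEq (V := fun y => U (t, y))
      (h := fun y => u (t, y)) (hstrict z hz) (hne z hz)
      (Filter.eventually_of_mem (hIopen.mem_nhds hz) (hU t))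
    rwa [one_div, inv_inv] at h
  have hflux : dx (fun q => U q ^ n * dx U q) (t, X x)
      = g x * dx (fun q => g q.2 * u q ^ n * dx u q) (t, x) := by
    have h := deriv_eq_inv_mul_deriv_of_comp_eventuallyEq
      (V := fun y => U (t, y) ^ n * dx U (t, y))
      (h := fun y => g y * u (t, y) ^ n * dx u (t, y)) (hstrict x hx) (hne x hx)
      (Filter.eventually_of_mem (hIopen.mem_nhds hx) fun z hz => by
        change U (t, X z) ^ n * dx U (t, X z) = g z * u (t, z) ^ n * dx u (t, z)
        rw [hU t z hz, hdx z hz]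
        ring)
    rwa [one_div, inv_inv] at h
  have hdt : dt U (t, X x) = dt u (t, x) := by
    simp only [dt, hU _ x hx]
  rw [hflux, hdt, hF x hx, ← heq t x hx, mul_assoc]
end

section
/- Let n ≠ 0 be real, let h : I → ℝ be continuous on an open interval I, let H : I → ℝ satisfy H' = h, and let X : I → ℝ satisfy X'(x) = e^{-H(x)}, so that X is a diffeomorphism of I onto an interval J. Suppose u : ℝ × I → ℝ is a twice continuously differentiable positive solution of the porous medium equation u_t = (u^n)_{xx} + h(x)·(u^n)_x. Define ũ : ℝ × J → ℝ by ũ(t, X(x)) = u(t, x) and f̃ : J → ℝ by f̃(X(x)) = e^{2H(x)}/n. Then ũ solves f̃(x̃)·ũ_t = (ũ^{n-1}·ũ_{x̃})_{x̃} on ℝ × J. Hence the transformation t̃ = t, x̃ = ∫e^{-∫h dx}dx, ũ = u maps the subclass of porous medium equations u_t = (u^n)_{xx} + h(x)(u^n)_x to the class f(x)u_t = (u^ñ u_x)_x with ñ = n - 1. -/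
/-- If `W ∘ X = w` near `x` and `X` has a nonzero strict derivative at `x`, then `W` is
differentiable at `X x`, with derivative given by the chain rule. -/
theorem hasDerivAt_of_comp_eventuallyEq {W X w : ℝ → ℝ} {x X' w' : ℝ}
    (hX : HasStrictDerivAt X X' x) (hX' : X' ≠ 0)
    (hw : HasDerivAt w w' x) (hW : ∀ᶠ z in nhds x, W (X z) = w z) :
    HasDerivAt W (w' * X'⁻¹) (X x) := by
  have hf := hX.hasStrictFDerivAt_equiv hX'
  have hg := (hX.to_localInverse hX').hasDerivAt
  have hgx : hX.localInverse X X' x hX' (X x) = x := hf.localInverse_apply_image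
  have hXg : ∀ᶠ y in nhds (X x), X (hX.localInverse X X' x hX' y) = y :=
    hf.eventually_right_inverse
  rw [← hgx] at hw
  refine (hw.comp (X x) hg).congr_of_eventuallyEq ?_
  have hcont := hg.continuousAt.tendsto
  rw [hgx] at hcont
  filter_upwards [hXg, hcont.eventually hW] with y hy hy'
  rw [hy] at hy'
  exact hy'

/-- The transformation `t̃ = t`, `x̃ = X(x)` with `X' = e^{-H}`, `H' = h`, `ũ = u`
maps the porous medium equation `u_t = (u^n)_xx + h(x) (u^n)_x` to the inhomogeneous
diffusion equation `f̃(x̃) ũ_t = (ũ^(n-1) ũ_x̃)_x̃` with `f̃(X(x)) = e^{2H(x)}/n`. -/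
theorem porous_medium_to_diffusion (n : ℝ) (hn : n ≠ 0)
    (I : Set ℝ) (hIopen : IsOpen I) (hIconn : I.OrdConnected)
    (h : ℝ → ℝ) (hh : ContinuousOn h I)
    (H : ℝ → ℝ) (hH : ∀ x ∈ I, HasDerivAt H (h x) x)
    (X : ℝ → ℝ) (hX : ∀ x ∈ I, HasDerivAt X (Real.exp (-H x)) x)
    (u : ℝ × ℝ → ℝ)
    (hu : ContDiffOn ℝ 2 u (Set.univ ×ˢ I))
    (hupos : ∀ t : ℝ, ∀ x ∈ I, 0 < u (t, x))
    (heq : ∀ t : ℝ, ∀ x ∈ I,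
      dt u (t, x) = dx (fun q => dx (fun r => u r ^ n) q) (t, x)
        + h x * dx (fun q => u q ^ n) (t, x))
    (U : ℝ × ℝ → ℝ) (F : ℝ → ℝ)
    (hU : ∀ t : ℝ, ∀ x ∈ I, U (t, X x) = u (t, x))
    (hF : ∀ x ∈ I, F (X x) = Real.exp (2 * H x) / n) :
    ∀ t : ℝ, ∀ y ∈ X '' I,
      F y * dt U (t, y) = dx (fun q => U q ^ (n - 1) * dx U q) (t, y) := by
  rintro t _ ⟨x, hx, rfl⟩
  have hXs : ∀ z ∈ I, HasStrictDerivAt X (Real.exp (-H z)) z := fun z hz =>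
    hasStrictDerivAt_of_hasDerivAt_of_continuousAt
      (Filter.eventually_of_mem (hIopen.mem_nhds hz) hX) (hH z hz).continuousAt.neg.rexp
  have hv : ContDiffOn ℝ 2 (fun z => u (t, z)) I :=
    hu.comp (by fun_prop) fun z hz => ⟨Set.mem_univ _, hz⟩
  have hvn : ContDiffOn ℝ 2 (fun z => u (t, z) ^ n) I :=
    hv.rpow_const_of_ne fun z hz => (hupos t z hz).ne'
  have hv1 : ∀ z ∈ I, HasDerivAt (fun z => u (t, z)) (dx u (t, z)) z := fun z hz =>
    ((hv.differentiableOn (by norm_num)).differentiableAt (hIopen.mem_nhds hz)).hasDerivAt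
  have hvn1 : ∀ z ∈ I, dx (fun q => u q ^ n) (t, z)
      = dx u (t, z) * n * u (t, z) ^ (n - 1) := fun z hz =>
    ((hv1 z hz).rpow_const (Or.inl (hupos t z hz).ne')).deriv
  have hvn2 : HasDerivAt (fun z => dx (fun q => u q ^ n) (t, z))
      (dx (fun q => dx (fun r => u r ^ n) q) (t, x)) x := by
    have hd : ContDiffOn ℝ 1 (deriv fun z => u (t, z) ^ n) I :=
      hvn.deriv_of_isOpen hIopen (by norm_num)
    exact ((hd.differentiableOn (by norm_num)).differentiableAt
      (hIopen.mem_nhds hx)).hasDerivAt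
  have hU1 : ∀ z ∈ I, dx U (t, X z) = dx u (t, z) * (Real.exp (-H z))⁻¹ := fun z hz =>
    (hasDerivAt_of_comp_eventuallyEq (W := fun y => U (t, y)) (hXs z hz) (Real.exp_ne_zero _)
      (hv1 z hz) (Filter.eventually_of_mem (hIopen.mem_nhds hz) (hU t))).deriv
  have hflux : ∀ z ∈ I, U (t, X z) ^ (n - 1) * dx U (t, X z)
      = Real.exp (H z) * dx (fun q => u q ^ n) (t, z) / n := fun z hz => by
    rw [hU t z hz, hU1 z hz, hvn1 z hz, Real.exp_neg, inv_inv]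
    field_simp
  have hflux1 := hasDerivAt_of_comp_eventuallyEq
    (W := fun y => U (t, y) ^ (n - 1) * dx U (t, y)) (hXs x hx) (Real.exp_ne_zero _)
    (((hH x hx).exp.mul hvn2).div_const n)
    (Filter.eventually_of_mem (hIopen.mem_nhds hx) hflux)
  have hUt : dt U (t, X x) = dt u (t, x) := by
    simp only [dt, hU _ x hx]
  have hUx : dx (fun q => U q ^ (n - 1) * dx U q) (t, X x) = _ := hflux1.deriv
  rw [hUx, hUt, hF x hx, heq t x hx, Real.exp_neg, inv_inv, two_mul, Real.exp_add]
  ring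
end

section
/- Let n ≠ -1, n ≠ 0 be real, let f : (0,∞) → ℝ, and suppose u, v¹, v² : ℝ × (0,∞) → ℝ are continuously differentiable with u positive and satisfy v¹_x = f(x)·u, v¹_t = u^n·u_x, v²_x = x·f(x)·u, v²_t = x·u^n·u_x - u^{n+1}/(n+1). Define t̃ = t, x̃ = 1/x, ũ(t̃, x̃) = x^{-1/(n+1)}·u(t,x), ṽ¹(t̃, x̃) = -v²(t,x), ṽ²(t̃, x̃) = -v¹(t,x), and f̃(x̃) = x̃^{-(3n+4)/(n+1)}·f(1/x̃). Then (ũ, ṽ¹, ṽ²) satisfies the same united potential system with arbitrary element f̃: ṽ¹_{x̃} = f̃·ũ, ṽ¹_{t̃} = ũ^n·ũ_{x̃}, ṽ²_{x̃} = x̃·f̃·ũ, ṽ²_{t̃} = x̃·ũ^n·ũ_{x̃} - ũ^{n+1}/(n+1). In particular this transformation interchanges the two first-level potential systems of the class f(x)u_t = (u^n u_x)_x. -/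
open Set Filter Topology in
/-- A function that is `C¹` on the half-plane `x > 0` has `dx` as its derivative in `x`. -/
theorem hasDerivAt_dx {w : ℝ × ℝ → ℝ} (hw : ContDiffOn ℝ 1 w (univ ×ˢ Ioi (0 : ℝ)))
    (t : ℝ) {x : ℝ} (hx : 0 < x) : HasDerivAt (fun y => w (t, y)) (dx w (t, x)) x := by
  have hopen : IsOpen ((univ : Set ℝ) ×ˢ Ioi (0 : ℝ)) := isOpen_univ.prod isOpen_Ioi
  have hmem : (t, x) ∈ (univ : Set ℝ) ×ˢ Ioi (0 : ℝ) := ⟨mem_univ _, hx⟩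
  have hd : DifferentiableAt ℝ w (t, x) :=
    (hw.contDiffAt (hopen.mem_nhds hmem)).differentiableAt one_ne_zero
  have hline : DifferentiableAt ℝ (fun y : ℝ => (t, y)) x := by fun_prop
  exact (hd.comp x hline).hasDerivAt

/-- Chain rule in `x` for the reflection `x ↦ x⁻¹` of a `C¹` function on `x > 0`. -/
theorem hasDerivAt_comp_inv {w : ℝ × ℝ → ℝ}
    (hw : ContDiffOn ℝ 1 w (Set.univ ×ˢ Set.Ioi (0 : ℝ))) (t : ℝ) {y : ℝ} (hy : 0 < y) :
    HasDerivAt (fun z => w (t, z⁻¹)) (dx w (t, y⁻¹) * -(y ^ 2)⁻¹) y :=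
  (hasDerivAt_dx hw t (inv_pos.mpr hy)).comp y (hasDerivAt_inv hy.ne')

open Filter Topology in
/-- If `W (t, x⁻¹) = -w (t, x)` on `x > 0`, then `W_y (t, y) = w_x (t, y⁻¹) / y²`. -/
theorem dx_eq_of_neg_reflection {w W : ℝ × ℝ → ℝ}
    (hw : ContDiffOn ℝ 1 w (Set.univ ×ˢ Set.Ioi (0 : ℝ)))
    (hW : ∀ t x : ℝ, 0 < x → W (t, x⁻¹) = -w (t, x)) (t : ℝ) {y : ℝ} (hy : 0 < y) :
    dx W (t, y) = dx w (t, y⁻¹) * (y ^ 2)⁻¹ := by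
  have heq : (fun z => W (t, z)) =ᶠ[𝓝 y] fun z => -w (t, z⁻¹) := by
    filter_upwards [lt_mem_nhds hy] with z hz
    simpa using hW t z⁻¹ (inv_pos.mpr hz)
  have h := ((hasDerivAt_comp_inv hw t hy).neg.congr_of_eventuallyEq heq).deriv
  simpa [dx] using h

/-- If `W (t, x⁻¹) = -w (t, x)` on `x > 0`, then `W_t (t, y) = -w_t (t, y⁻¹)`. -/
theorem dt_eq_of_neg_reflection {w W : ℝ × ℝ → ℝ}
    (hW : ∀ t x : ℝ, 0 < x → W (t, x⁻¹) = -w (t, x)) (t : ℝ) {y : ℝ} (hy : 0 < y) :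
    dt W (t, y) = -dt w (t, y⁻¹) := by
  have heq : (fun s => W (s, y)) = fun s => -w (s, y⁻¹) := by
    funext s
    simpa using hW s y⁻¹ (inv_pos.mpr hy)
  simp only [dt, heq, deriv.fun_neg]

open Filter Topology in
/-- The derivative of `y ↦ y ^ a * u (t, y⁻¹)`. -/
theorem dx_eq_of_rpow_reflection {u U : ℝ × ℝ → ℝ} {a : ℝ}
    (hu : ContDiffOn ℝ 1 u (Set.univ ×ˢ Set.Ioi (0 : ℝ)))
    (hU : ∀ t y : ℝ, 0 < y → U (t, y) = y ^ a * u (t, y⁻¹)) (t : ℝ) {y : ℝ} (hy : 0 < y) :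
    dx U (t, y) =
      a * y ^ (a - 1) * u (t, y⁻¹) + y ^ a * (dx u (t, y⁻¹) * -(y ^ 2)⁻¹) := by
  have heq : (fun z => U (t, z)) =ᶠ[𝓝 y] fun z => z ^ a * u (t, z⁻¹) := by
    filter_upwards [lt_mem_nhds hy] with z hz using hU t z hz
  exact (((Real.hasDerivAt_rpow_const (Or.inl hy.ne')).mul
    (hasDerivAt_comp_inv hu t hy)).congr_of_eventuallyEq heq).deriv

/-- The transformation `t̃ = t`, `x̃ = 1/x`, `ũ = x^(-1/(n+1)) u`, `ṽ¹ = -v²`,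
`ṽ² = -v¹`, `f̃(x̃) = x̃^(-(3n+4)/(n+1)) f(1/x̃)` maps the united potential system of
`f(x) u_t = (u^n u_x)_x` on `x > 0` to the same united potential system with `f̃`,
interchanging the two first-level potential systems. -/
theorem potential_systems_interchange (n : ℝ) (hn1 : n ≠ -1) (hn0 : n ≠ 0) (f : ℝ → ℝ)
    (u v1 v2 : ℝ × ℝ → ℝ)
    (hu : ContDiffOn ℝ 1 u (Set.univ ×ˢ Set.Ioi (0 : ℝ)))
    (hv1 : ContDiffOn ℝ 1 v1 (Set.univ ×ˢ Set.Ioi (0 : ℝ)))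
    (hv2 : ContDiffOn ℝ 1 v2 (Set.univ ×ˢ Set.Ioi (0 : ℝ)))
    (hupos : ∀ p : ℝ × ℝ, 0 < p.2 → 0 < u p)
    (h1x : ∀ p : ℝ × ℝ, 0 < p.2 → dx v1 p = f p.2 * u p)
    (h1t : ∀ p : ℝ × ℝ, 0 < p.2 → dt v1 p = u p ^ n * dx u p)
    (h2x : ∀ p : ℝ × ℝ, 0 < p.2 → dx v2 p = p.2 * f p.2 * u p)
    (h2t : ∀ p : ℝ × ℝ, 0 < p.2 →
      dt v2 p = p.2 * u p ^ n * dx u p - u p ^ (n + 1) / (n + 1))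
    (U V1 V2 : ℝ × ℝ → ℝ) (F : ℝ → ℝ)
    (hU : ∀ t x : ℝ, 0 < x → U (t, x⁻¹) = x ^ (-(1 / (n + 1))) * u (t, x))
    (hV1 : ∀ t x : ℝ, 0 < x → V1 (t, x⁻¹) = -v2 (t, x))
    (hV2 : ∀ t x : ℝ, 0 < x → V2 (t, x⁻¹) = -v1 (t, x))
    (hF : ∀ y : ℝ, 0 < y → F y = y ^ (-((3 * n + 4) / (n + 1))) * f y⁻¹) :
    ∀ p : ℝ × ℝ, 0 < p.2 →
      dx V1 p = F p.2 * U p ∧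
      dt V1 p = U p ^ n * dx U p ∧
      dx V2 p = p.2 * F p.2 * U p ∧
      dt V2 p = p.2 * U p ^ n * dx U p - U p ^ (n + 1) / (n + 1) := by
  rintro ⟨t, y⟩ hy
  replace hy : 0 < y := hy
  have hn : n + 1 ≠ 0 := fun h => hn1 (by linarith)
  have hyi : 0 < y⁻¹ := inv_pos.mpr hy
  have hUy : ∀ t y : ℝ, 0 < y → U (t, y) = y ^ (1 / (n + 1)) * u (t, y⁻¹) := by
    intro t y hy
    have h := hU t y⁻¹ (inv_pos.mpr hy)
    rwa [inv_inv, Real.inv_rpow hy.le, Real.rpow_neg hy.le, inv_inv] at h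
  have hFU : F y * U (t, y) = (y ^ 3)⁻¹ * (f y⁻¹ * u (t, y⁻¹)) := by
    have hexp : y ^ (-((3 * n + 4) / (n + 1))) * y ^ (1 / (n + 1)) = (y ^ 3)⁻¹ := by
      rw [← Real.rpow_add hy,
        show -((3 * n + 4) / (n + 1)) + 1 / (n + 1) = -(3 : ℕ) by push_cast; field_simp; ring,
        Real.rpow_neg hy.le, Real.rpow_natCast]
    rw [hF y hy, hUy t y hy, ← hexp]
    ring
  have hupos' : 0 < u (t, y⁻¹) := hupos (t, y⁻¹) hyi
  have hu_pow : u (t, y⁻¹) ^ (n + 1) = u (t, y⁻¹) ^ n * u (t, y⁻¹) :=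
    Real.rpow_add_one hupos'.ne' n
  have hy_pow : (y ^ (1 / (n + 1))) ^ n * y ^ (1 / (n + 1)) = y := by
    rw [← Real.rpow_add_one (Real.rpow_pos_of_pos hy _).ne', ← Real.rpow_mul hy.le,
      one_div_mul_cancel hn, Real.rpow_one]
  have hU_pow : U (t, y) ^ (n + 1) = y * u (t, y⁻¹) ^ (n + 1) := by
    rw [hUy t y hy, Real.mul_rpow (Real.rpow_nonneg hy.le _) hupos'.le, ← Real.rpow_mul hy.le,
      one_div_mul_cancel hn, Real.rpow_one]
  have hflux : U (t, y) ^ n * dx U (t, y) =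
      u (t, y⁻¹) ^ (n + 1) / (n + 1) - y⁻¹ * u (t, y⁻¹) ^ n * dx u (t, y⁻¹) := by
    rw [dx_eq_of_rpow_reflection hu hUy t hy, hUy t y hy,
      Real.mul_rpow (Real.rpow_nonneg hy.le _) hupos'.le, Real.rpow_sub_one hy.ne', hu_pow]
    calc _ = ((y ^ (1 / (n + 1))) ^ n * y ^ (1 / (n + 1))) *
          (u (t, y⁻¹) ^ n * (1 / (n + 1) * y⁻¹ * u (t, y⁻¹) - dx u (t, y⁻¹) * (y ^ 2)⁻¹)) := by
          ring
      _ = _ := by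
          rw [hy_pow]
          field_simp
  refine ⟨?_, ?_, ?_, ?_⟩
  · rw [dx_eq_of_neg_reflection hv2 hV1 t hy, h2x _ hyi, hFU]
    field_simp
  · rw [dt_eq_of_neg_reflection hV1 t hy, h2t _ hyi, hflux]
    ring
  · rw [dx_eq_of_neg_reflection hv1 hV2 t hy, h1x _ hyi, mul_assoc (t, y).2, hFU]
    field_simp
  · rw [dt_eq_of_neg_reflection hV2 t hy, h1t _ hyi, mul_assoc (t, y).2, hflux, hU_pow]
    field_simp
    ring
end

section
/- Let n ≠ 1, n ≠ 0 be real, let f : ℝ → ℝ be continuously differentiable, and let Φ satisfy Φ' = f. Suppose u : ℝ × ℝ → ℝ is a twice continuously differentiable positive solution of u_t = ((u^n)_x + f(x))_x on an open set Ω (the case m = 0). Then ∂_t(x·u) + ∂_x(-x·(n·u^{n-1}·u_x + f(x)) + u^n + Φ(x)) = 0 on Ω; that is, F = xu, G = -x(n u^{n-1}u_x + f) + u^n + ∫f dx is a conserved vector additional to the obvious one. -/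
/-- For the porous medium equation `u_t = ((u^n)_x + f(x))_x` (the case `m = 0`),
with `Φ' = f`, the pair `F = x u`, `G = -x (n u^(n-1) u_x + f) + u^n + Φ` is a
conserved vector. -/
theorem conserved_vector_m_eq_zero (n : ℝ) (hn1 : n ≠ 1) (hn0 : n ≠ 0)
    (f : ℝ → ℝ) (hf : ContDiff ℝ 1 f)
    (Φ : ℝ → ℝ) (hΦ : ∀ x : ℝ, HasDerivAt Φ (f x) x)
    (u : ℝ × ℝ → ℝ) (Ω : Set (ℝ × ℝ)) (hΩ : IsOpen Ω)
    (hu : ContDiffOn ℝ 2 u Ω) (hupos : ∀ p ∈ Ω, 0 < u p)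
    (heq : ∀ p ∈ Ω,
      dt u p = dx (fun q => dx (fun r => u r ^ n) q + f q.2) p) :
    ∀ p ∈ Ω,
      dt (fun q => q.2 * u q) p
        + dx (fun q => -(q.2 * (n * u q ^ (n - 1) * dx u q + f q.2))
            + u q ^ n + Φ q.2) p = 0 := by
  rintro ⟨t, x⟩ hp
  set V : Set ℝ := {y | (t, y) ∈ Ω}
  have hVo : IsOpen V := hΩ.preimage (by fun_prop : Continuous fun y : ℝ => (t, y))
  have hg : ContDiffOn ℝ 2 (fun y => u (t, y)) V :=
    hu.comp (by fun_prop : ContDiff ℝ 2 fun y : ℝ => (t, y)).contDiffOn fun _ hy => hy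
  have hh : ContDiffOn ℝ 2 (fun y => u (t, y) ^ n) V :=
    hg.rpow_const_of_ne fun y hy => (hupos _ hy).ne'
  have hhx : HasDerivAt (fun y => u (t, y) ^ n) (deriv (fun y => u (t, y) ^ n) x) x :=
    ((hh.differentiableOn (by norm_num)).differentiableAt (hVo.mem_nhds hp)).hasDerivAt
  have hh' : DifferentiableAt ℝ (deriv fun y => u (t, y) ^ n) x :=
    ((hh.deriv_of_isOpen hVo (m := 1) (by norm_num)).differentiableOn
      (by norm_num)).differentiableAt (hVo.mem_nhds hp)
  have hW : HasDerivAt (fun y => deriv (fun z => u (t, z) ^ n) y + f y)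
      (deriv (fun y => deriv (fun z => u (t, z) ^ n) y + f y) x) x :=
    (hh'.add (hf.differentiable (by norm_num) x)).hasDerivAt
  have hchain : ∀ y ∈ V, n * u (t, y) ^ (n - 1) * deriv (fun z => u (t, z)) y
      = deriv (fun z => u (t, z) ^ n) y := fun y hy => by
    have hgy := ((hg.differentiableOn (by norm_num)).differentiableAt
      (hVo.mem_nhds hy)).hasDerivAt
    rw [(hgy.rpow_const (Or.inl (hupos _ hy).ne')).deriv]
    ring
  have hG : (fun y => -(y * (n * u (t, y) ^ (n - 1) * deriv (fun z => u (t, z)) y + f y))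
        + u (t, y) ^ n + Φ y) =ᶠ[nhds x]
      fun y => -(y * (deriv (fun z => u (t, z) ^ n) y + f y)) + u (t, y) ^ n + Φ y := by
    filter_upwards [hVo.mem_nhds hp] with y hy
    rw [hchain y hy]
  have hGx := (((hasDerivAt_id' x).mul hW).neg.add hhx).add (hΦ x)
  have hpde := heq _ hp
  simp only [dt, dx] at hpde ⊢
  rw [deriv_const_mul_field, hpde, hG.deriv_eq]
  refine (congrArg _ hGx.deriv).trans ?_
  ring
end

section
/- Let n ≠ 1, n ≠ 0 be real and suppose u : ℝ × ℝ → ℝ is a twice continuously differentiable positive solution of u_t = ((u^n)_x + u)_x on an open set Ω (the case m = 1, f = 1). Then ∂_t((t+x)·u) + ∂_x(-(t+x)·(n·u^{n-1}·u_x + u) + u^n) = 0 on Ω; that is, F = (t+x)u, G = -(t+x)(n u^{n-1}u_x + u) + u^n is a conserved vector additional to the obvious one. -/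
open Topology

theorem hasDerivAt_fst {u : ℝ × ℝ → ℝ} {p : ℝ × ℝ} (h : DifferentiableAt ℝ u p) :
    HasDerivAt (fun s => u (s, p.2)) (fderiv ℝ u p (1, 0)) p.1 :=
  h.hasFDerivAt.comp_hasDerivAt (f := fun s => (s, p.2)) p.1
    ((hasDerivAt_id p.1).prodMk (hasDerivAt_const p.1 p.2))

theorem hasDerivAt_snd {u : ℝ × ℝ → ℝ} {p : ℝ × ℝ} (h : DifferentiableAt ℝ u p) :
    HasDerivAt (fun y => u (p.1, y)) (fderiv ℝ u p (0, 1)) p.2 :=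
  h.hasFDerivAt.comp_hasDerivAt (f := fun y => (p.1, y)) p.2
    ((hasDerivAt_const p.2 p.1).prodMk (hasDerivAt_id p.2))

theorem differentiableAt_dx_snd {u : ℝ × ℝ → ℝ} {p : ℝ × ℝ} (h : ContDiffAt ℝ 2 u p) :
    DifferentiableAt ℝ (fun y => dx u (p.1, y)) p.2 := by
  have hev : ∀ᶠ q in 𝓝 p, dx u q = fderiv ℝ u q (0, 1) := by
    filter_upwards [h.eventually (by norm_num)] with q hq
    exact (hasDerivAt_snd (hq.differentiableAt (by norm_num))).deriv
  have hd : DifferentiableAt ℝ (fun q => fderiv ℝ u q (0, 1)) p :=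
    ((h.fderiv_right (m := 1) (by norm_num)).differentiableAt (by norm_num)).clm_apply
      (differentiableAt_const _)
  exact (hasDerivAt_snd (hd.congr_of_eventuallyEq hev)).differentiableAt

/-- For the porous medium equation `u_t = ((u^n)_x + u)_x` (the case `m = 1`, `f = 1`),
the pair `F = (t + x) u`, `G = -(t + x)(n u^(n-1) u_x + u) + u^n` is a conserved
vector. -/
theorem conserved_vector_m_eq_one_f_eq_one (n : ℝ) (hn1 : n ≠ 1) (hn0 : n ≠ 0)
    (u : ℝ × ℝ → ℝ) (Ω : Set (ℝ × ℝ)) (hΩ : IsOpen Ω)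
    (hu : ContDiffOn ℝ 2 u Ω) (hupos : ∀ p ∈ Ω, 0 < u p)
    (heq : ∀ p ∈ Ω,
      dt u p = dx (fun q => dx (fun r => u r ^ n) q + u q) p) :
    ∀ p ∈ Ω,
      dt (fun q => (q.1 + q.2) * u q) p
        + dx (fun q => -((q.1 + q.2) * (n * u q ^ (n - 1) * dx u q + u q))
            + u q ^ n) p = 0 := by
  intro p hp
  obtain ⟨t, x⟩ := p
  have hud : ∀ q ∈ Ω, DifferentiableAt ℝ u q := fun q hq =>
    (hu.contDiffAt (hΩ.mem_nhds hq)).differentiableAt (by norm_num)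
  have hux : ∀ q ∈ Ω, HasDerivAt (fun y => u (q.1, y)) (dx u q) q.2 := fun q hq =>
    (hasDerivAt_snd (hud q hq)).differentiableAt.hasDerivAt
  have hut : HasDerivAt (fun s => u (s, x)) (dt u (t, x)) t :=
    (hasDerivAt_fst (hud (t, x) hp)).differentiableAt.hasDerivAt
  have hpow : ∀ q ∈ Ω, dx (fun r => u r ^ n) q = n * u q ^ (n - 1) * dx u q := by
    intro q hq
    have h : HasDerivAt (fun y => u (q.1, y) ^ n) (dx u q * n * u q ^ (n - 1)) q.2 :=
      (hux q hq).rpow_const (Or.inl (hupos q hq).ne')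
    calc dx (fun r => u r ^ n) q = dx u q * n * u q ^ (n - 1) := h.deriv
      _ = n * u q ^ (n - 1) * dx u q := by ring
  have hslice : ∀ᶠ y in 𝓝 x, (t, y) ∈ Ω :=
    (Continuous.prodMk_right t).continuousAt.preimage_mem_nhds (hΩ.mem_nhds hp)
  have huxx : DifferentiableAt ℝ (fun y => dx u (t, y)) x :=
    differentiableAt_dx_snd (hu.contDiffAt (hΩ.mem_nhds hp))
  have hu0 : u (t, x) ≠ 0 := (hupos (t, x) hp).ne'
  have hflux : DifferentiableAt ℝ
      (fun y => n * u (t, y) ^ (n - 1) * dx u (t, y) + u (t, y)) x :=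
    ((((hux (t, x) hp).differentiableAt.rpow_const (Or.inl hu0)).const_mul n).mul huxx).add
      (hux (t, x) hp).differentiableAt
  have hflux' : HasDerivAt
      (fun y => n * u (t, y) ^ (n - 1) * dx u (t, y) + u (t, y)) (dt u (t, x)) x := by
    have hcongr : (fun y => dx (fun r => u r ^ n) (t, y) + u (t, y)) =ᶠ[𝓝 x]
        fun y => n * u (t, y) ^ (n - 1) * dx u (t, y) + u (t, y) := by
      filter_upwards [hslice] with y hy
      rw [hpow (t, y) hy]
    rw [heq (t, x) hp]
    exact hflux.hasDerivAt.congr_deriv hcongr.deriv_eq.symm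
  have hF : dt (fun q => (q.1 + q.2) * u q) (t, x) = 1 * u (t, x) + (t + x) * dt u (t, x) :=
    (((hasDerivAt_id t).add_const x).mul hut).deriv
  have hpow' : HasDerivAt (fun y => u (t, y) ^ n) (dx u (t, x) * n * u (t, x) ^ (n - 1)) x :=
    (hux (t, x) hp).rpow_const (Or.inl hu0)
  have hG : dx (fun q => -((q.1 + q.2) * (n * u q ^ (n - 1) * dx u q + u q)) + u q ^ n) (t, x) =
      -(1 * (n * u (t, x) ^ (n - 1) * dx u (t, x) + u (t, x)) + (t + x) * dt u (t, x))
        + dx u (t, x) * n * u (t, x) ^ (n - 1) :=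
    ((((hasDerivAt_id x).const_add t).mul hflux').neg.add hpow').deriv
  rw [hF, hG]
  ring
end

section
/- Let n ≠ 1, n ≠ 0 be real, let ε = ±1, and suppose u : ℝ × ℝ → ℝ is a twice continuously differentiable positive solution of u_t = ((u^n)_x + ε·x·u)_x on an open set Ω (the case m = 1, f = εx). Then ∂_t(e^{εt}·x·u) + ∂_x(-e^{εt}·x·(n·u^{n-1}·u_x + ε·x·u) + e^{εt}·u^n) = 0 on Ω; that is, F = e^{εt}xu together with the flux G = -e^{εt}x(n u^{n-1}u_x + εxu) + e^{εt}u^n is a conserved vector additional to the obvious one. -/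
open Filter Topology in
/-- For a positive `C¹` function, `(u^n)_x = n u^(n-1) u_x` at all points near `x` on the time slice. -/
theorem eventually_hasDerivAt_rpow_slice {n : ℝ} {u : ℝ × ℝ → ℝ} {Ω : Set (ℝ × ℝ)} (hΩ : IsOpen Ω)
    (hu : ContDiffOn ℝ 1 u Ω) (hupos : ∀ p ∈ Ω, 0 < u p) {t x : ℝ} (hp : (t, x) ∈ Ω) :
    ∀ᶠ y in 𝓝 x, HasDerivAt (fun z => u (t, z) ^ n)
      (n * u (t, y) ^ (n - 1) * dx u (t, y)) y := by
  have hslice : Continuous fun y : ℝ => (t, y) := by fun_prop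
  filter_upwards [hslice.continuousAt.eventually (hΩ.mem_nhds hp)] with y hy
  have hd : DifferentiableAt ℝ (fun z => u (t, z)) y :=
    ((hu.contDiffAt (hΩ.mem_nhds hy)).differentiableAt (by norm_num)).comp y (by fun_prop)
  refine (hd.hasDerivAt.rpow_const (Or.inl (hupos _ hy).ne')).congr_deriv ?_
  simp only [dx]
  ring

/-- For the porous medium equation `u_t = ((u^n)_x + ε x u)_x` (the case `m = 1`,
`f = ε x`, `ε = ±1`), the pair `F = e^{εt} x u`,
`G = -e^{εt} x (n u^(n-1) u_x + ε x u) + e^{εt} u^n` is a conserved vector. -/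
theorem conserved_vector_m_eq_one_f_eq_eps_x (n : ℝ) (hn1 : n ≠ 1) (hn0 : n ≠ 0)
    (ε : ℝ) (hε : ε = 1 ∨ ε = -1)
    (u : ℝ × ℝ → ℝ) (Ω : Set (ℝ × ℝ)) (hΩ : IsOpen Ω)
    (hu : ContDiffOn ℝ 2 u Ω) (hupos : ∀ p ∈ Ω, 0 < u p)
    (heq : ∀ p ∈ Ω,
      dt u p = dx (fun q => dx (fun r => u r ^ n) q + ε * q.2 * u q) p) :
    ∀ p ∈ Ω,
      dt (fun q => Real.exp (ε * q.1) * q.2 * u q) p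
        + dx (fun q => -(Real.exp (ε * q.1) * q.2
              * (n * u q ^ (n - 1) * dx u q + ε * q.2 * u q))
            + Real.exp (ε * q.1) * u q ^ n) p = 0 := by
  rintro ⟨t, x⟩ hp
  have hpow := eventually_hasDerivAt_rpow_slice (n := n) hΩ (hu.of_le (by norm_num)) hupos hp
  have hup := hu.contDiffAt (hΩ.mem_nhds hp)
  have hux : ContDiffAt ℝ 2 (fun y => u (t, y)) x := hup.comp x (by fun_prop)
  have hut : DifferentiableAt ℝ (fun s => u (s, x)) t :=
    (hup.differentiableAt (by norm_num)).comp t (by fun_prop)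
  have hd : DifferentiableAt ℝ (fun y => u (t, y)) x := hux.differentiableAt (by norm_num)
  have hdd : DifferentiableAt ℝ (fun y => dx u (t, y)) x := by
    have h : ContDiffAt ℝ 1 (deriv fun y => u (t, y)) x :=
      (hux.fderiv_right (by norm_num)).clm_apply contDiffAt_const
    exact h.differentiableAt (by norm_num)
  have hflux : HasDerivAt (fun y => n * u (t, y) ^ (n - 1) * dx u (t, y) + ε * y * u (t, y))
      (dt u (t, x)) x := by
    have hdiff : DifferentiableAt ℝ
        (fun y => n * u (t, y) ^ (n - 1) * dx u (t, y) + ε * y * u (t, y)) x :=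
      (((hd.rpow_const (Or.inl (hupos _ hp).ne')).const_mul n).mul hdd).add
        ((differentiableAt_id.const_mul ε).mul hd)
    refine hdiff.hasDerivAt.congr_deriv ?_
    rw [heq _ hp]
    refine Filter.EventuallyEq.deriv_eq ?_
    filter_upwards [hpow] with y hy
    simp only [dx] at hy ⊢
    rw [hy.deriv]
  have hF : HasDerivAt (fun s => Real.exp (ε * s) * x * u (s, x))
      (Real.exp (ε * t) * ε * x * u (t, x) + Real.exp (ε * t) * x * dt u (t, x)) t := by
    have hexp : HasDerivAt (fun s => Real.exp (ε * s)) (Real.exp (ε * t) * ε) t := by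
      simpa using ((hasDerivAt_id t).const_mul ε).exp
    exact (hexp.mul_const x).mul hut.hasDerivAt
  have hG := ((((hasDerivAt_id x).const_mul (Real.exp (ε * t))).mul hflux).neg).add
    (hpow.self_of_nhds.const_mul (Real.exp (ε * t)))
  have hFt : dt (fun q => Real.exp (ε * q.1) * q.2 * u q) (t, x) = _ := hF.deriv
  have hGx : dx (fun q => -(Real.exp (ε * q.1) * q.2
        * (n * u q ^ (n - 1) * dx u q + ε * q.2 * u q))
      + Real.exp (ε * q.1) * u q ^ n) (t, x) = _ := hG.deriv
  rw [hFt, hGx]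
  simp only [id]
  ring
end

section
/- Let f : ℝ → ℝ be continuously differentiable, let α : ℝ × ℝ → ℝ be twice continuously differentiable and satisfy the backward heat equation α_t + α_{xx} = 0, and let Ψ : ℝ × ℝ → ℝ satisfy Ψ_x(t,x) = α_x(t,x)·f(x). Suppose u : ℝ × ℝ → ℝ is a twice continuously differentiable solution of u_t = (u_x + f(x))_x on an open set Ω (the case n = 1, m = 0). Then ∂_t(α·u) + ∂_x(-α·(u_x + f) + α_x·u + Ψ) = 0 on Ω; that is, F = αu, G = -α(u_x + f) + α_x u + ∫α_x f dx is a conserved vector. -/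
theorem DifferentiableAt.hasDerivAt_dt {u : ℝ × ℝ → ℝ} {p : ℝ × ℝ}
    (h : DifferentiableAt ℝ u p) : HasDerivAt (fun s => u (s, p.2)) (dt u p) p.1 :=
  (h.comp (f := fun s : ℝ => (s, p.2)) p.1 (by fun_prop)).hasDerivAt

theorem DifferentiableAt.hasDerivAt_dx {u : ℝ × ℝ → ℝ} {p : ℝ × ℝ}
    (h : DifferentiableAt ℝ u p) : HasDerivAt (fun y => u (p.1, y)) (dx u p) p.2 :=
  (h.comp (f := fun y : ℝ => (p.1, y)) p.2 (by fun_prop)).hasDerivAt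

theorem DifferentiableAt.dx_eq_fderiv {u : ℝ × ℝ → ℝ} {p : ℝ × ℝ}
    (h : DifferentiableAt ℝ u p) : dx u p = fderiv ℝ u p (0, 1) :=
  (HasFDerivAt.comp_hasDerivAt (f := fun y : ℝ => (p.1, y)) p.2 h.hasFDerivAt
    ((hasDerivAt_const p.2 p.1).prodMk (hasDerivAt_id p.2))).deriv

theorem ContDiffAt.differentiableAt_dx {u : ℝ × ℝ → ℝ} {p : ℝ × ℝ}
    (h : ContDiffAt ℝ 2 u p) : DifferentiableAt ℝ (dx u) p := by
  have hd : DifferentiableAt ℝ (fun q => fderiv ℝ u q (0, 1)) p :=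
    ((h.fderiv_right (m := 1) (by norm_num)).differentiableAt (by norm_num)).clm_apply
      (differentiableAt_const _)
  refine hd.congr_of_eventuallyEq ?_
  filter_upwards [h.eventually (by simp)] with q hq
  exact (hq.differentiableAt (by norm_num)).dx_eq_fderiv

/-- For the linear equation `u_t = (u_x + f(x))_x` (the case `n = 1`, `m = 0`), if `α`
solves the backward heat equation `α_t + α_xx = 0` and `Ψ_x = α_x f`, then
`F = α u`, `G = -α (u_x + f) + α_x u + Ψ` is a conserved vector. -/
theorem conserved_vector_n_eq_one_m_eq_zero
    (f : ℝ → ℝ) (hf : ContDiff ℝ 1 f)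
    (α : ℝ × ℝ → ℝ) (hα : ContDiff ℝ 2 α)
    (hαeq : ∀ p : ℝ × ℝ, dt α p + dx (dx α) p = 0)
    (Ψ : ℝ × ℝ → ℝ)
    (hΨ : ∀ p : ℝ × ℝ, HasDerivAt (fun y => Ψ (p.1, y)) (dx α p * f p.2) p.2)
    (u : ℝ × ℝ → ℝ) (Ω : Set (ℝ × ℝ)) (hΩ : IsOpen Ω)
    (hu : ContDiffOn ℝ 2 u Ω)
    (heq : ∀ p ∈ Ω, dt u p = dx (fun q => dx u q + f q.2) p) :
    ∀ p ∈ Ω,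
      dt (fun q => α q * u q) p
        + dx (fun q => -(α q * (dx u q + f q.2)) + dx α q * u q + Ψ q) p = 0 := by
  intro p hp
  have hup : ContDiffAt ℝ 2 u p := hu.contDiffAt (hΩ.mem_nhds hp)
  have hdu : DifferentiableAt ℝ u p := hup.differentiableAt (by norm_num)
  have hdα : DifferentiableAt ℝ α p := hα.contDiffAt.differentiableAt (by norm_num)
  have hux := hup.differentiableAt_dx.hasDerivAt_dx
  have hαx := hα.contDiffAt.differentiableAt_dx.hasDerivAt_dx (p := p)
  have hf' : HasDerivAt f (deriv f p.2) p.2 :=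
    (hf.differentiable (by norm_num) p.2).hasDerivAt
  have hflux := hux.add hf'
  have hF : dt (fun q => α q * u q) p = dt α p * u p + α p * dt u p :=
    (hdα.hasDerivAt_dt.mul hdu.hasDerivAt_dt).deriv
  have hflux_eq : dx (fun q => dx u q + f q.2) p = dx (dx u) p + deriv f p.2 := hflux.deriv
  have hG : dx (fun q => -(α q * (dx u q + f q.2)) + dx α q * u q + Ψ q) p =
      -(dx α p * (dx u p + f p.2) + α p * (dx (dx u) p + deriv f p.2))
        + (dx (dx α) p * u p + dx α p * dx u p) + dx α p * f p.2 :=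
    (((hdα.hasDerivAt_dx.mul hflux).neg.add (hαx.mul hdu.hasDerivAt_dx)).add (hΨ p)).deriv
  rw [hF, hG, heq p hp, hflux_eq]
  linear_combination u p * hαeq p
end

section
/- Let C₁, C₁', C₂ be real constants. The function v(t, x) = (C₁·e^{x/√2} - C₁'·e^{-x/√2}) / (C₂·e^{-3t/2} + C₁·e^{x/√2} + C₁'·e^{-x/√2}) is an exact solution of the semilinear heat equation v_t = v_{xx} - v³ + v at every point (t, x) where the denominator C₂·e^{-3t/2} + C₁·e^{x/√2} + C₁'·e^{-x/√2} is nonzero. -/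
/-- The denominator `C₂ e^{-3t/2} + C₁ e^{x/√2} + C₁' e^{-x/√2}`. -/
noncomputable def denomSol (C₁ C₁' C₂ : ℝ) (p : ℝ × ℝ) : ℝ :=
  C₂ * Real.exp (-(3 * p.1 / 2)) + C₁ * Real.exp (p.2 / Real.sqrt 2)
    + C₁' * Real.exp (-(p.2 / Real.sqrt 2))

/-- The function `v = (C₁ e^{x/√2} - C₁' e^{-x/√2}) / (C₂ e^{-3t/2} + C₁ e^{x/√2} + C₁' e^{-x/√2})`. -/
noncomputable def vSol (C₁ C₁' C₂ : ℝ) (p : ℝ × ℝ) : ℝ :=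
  (C₁ * Real.exp (p.2 / Real.sqrt 2) - C₁' * Real.exp (-(p.2 / Real.sqrt 2)))
    / denomSol C₁ C₁' C₂ p

theorem hasDerivAt_exp_sub_exp_neg (A B c x : ℝ) :
    HasDerivAt (fun y => A * Real.exp (y / c) - B * Real.exp (-(y / c)))
      ((A * Real.exp (x / c) + B * Real.exp (-(x / c))) / c) x := by
  have h := (hasDerivAt_id x).div_const c
  refine ((h.exp.const_mul A).sub (h.neg.exp.const_mul B)).congr_deriv ?_
  simp only [id, Pi.neg_apply]
  ring

theorem hasDerivAt_exp_add_exp_neg (A B c x : ℝ) :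
    HasDerivAt (fun y => A * Real.exp (y / c) + B * Real.exp (-(y / c)))
      ((A * Real.exp (x / c) - B * Real.exp (-(x / c))) / c) x := by
  simpa [sub_eq_add_neg] using hasDerivAt_exp_sub_exp_neg A (-B) c x

theorem hasDerivAt_denomSol_snd (C₁ C₁' C₂ t x : ℝ) :
    HasDerivAt (fun y => denomSol C₁ C₁' C₂ (t, y))
      ((C₁ * Real.exp (x / Real.sqrt 2) - C₁' * Real.exp (-(x / Real.sqrt 2))) / Real.sqrt 2)
      x := by
  simpa only [denomSol, add_assoc] using
    (hasDerivAt_exp_add_exp_neg C₁ C₁' (Real.sqrt 2) x).const_add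
      (C₂ * Real.exp (-(3 * t / 2)))

theorem hasDerivAt_denomSol_fst (C₁ C₁' C₂ t x : ℝ) :
    HasDerivAt (fun s => denomSol C₁ C₁' C₂ (s, x))
      (-(3 / 2) * (C₂ * Real.exp (-(3 * t / 2)))) t := by
  have h := ((((hasDerivAt_id t).const_mul 3).div_const 2).neg.exp.const_mul C₂)
  refine ((h.add_const (C₁ * Real.exp (x / Real.sqrt 2))).add_const
    (C₁' * Real.exp (-(x / Real.sqrt 2)))).congr_deriv ?_
  simp only [id, Pi.neg_apply]
  ring

theorem dt_vSol (C₁ C₁' C₂ t x : ℝ) (h : denomSol C₁ C₁' C₂ (t, x) ≠ 0) :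
    dt (vSol C₁ C₁' C₂) (t, x) =
      3 / 2 * (C₂ * Real.exp (-(3 * t / 2)))
        * (C₁ * Real.exp (x / Real.sqrt 2) - C₁' * Real.exp (-(x / Real.sqrt 2)))
        / denomSol C₁ C₁' C₂ (t, x) ^ 2 := by
  refine (((hasDerivAt_const t
    (C₁ * Real.exp (x / Real.sqrt 2) - C₁' * Real.exp (-(x / Real.sqrt 2)))).div
    (hasDerivAt_denomSol_fst C₁ C₁' C₂ t x) h).deriv).trans ?_
  ring

theorem dx_vSol (C₁ C₁' C₂ t x : ℝ) (h : denomSol C₁ C₁' C₂ (t, x) ≠ 0) :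
    dx (vSol C₁ C₁' C₂) (t, x) =
      ((C₁ * Real.exp (x / Real.sqrt 2) + C₁' * Real.exp (-(x / Real.sqrt 2)))
          * denomSol C₁ C₁' C₂ (t, x)
        - (C₁ * Real.exp (x / Real.sqrt 2) - C₁' * Real.exp (-(x / Real.sqrt 2))) ^ 2)
        / denomSol C₁ C₁' C₂ (t, x) ^ 2 / Real.sqrt 2 := by
  refine (((hasDerivAt_exp_sub_exp_neg C₁ C₁' (Real.sqrt 2) x).div
    (hasDerivAt_denomSol_snd C₁ C₁' C₂ t x) h).deriv).trans ?_
  ring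

theorem dx_dx_vSol (C₁ C₁' C₂ t x : ℝ) (h : denomSol C₁ C₁' C₂ (t, x) ≠ 0) :
    dx (dx (vSol C₁ C₁' C₂)) (t, x) =
      (C₁ * Real.exp (x / Real.sqrt 2) - C₁' * Real.exp (-(x / Real.sqrt 2)))
        * (denomSol C₁ C₁' C₂ (t, x) ^ 2
          - 3 * (C₁ * Real.exp (x / Real.sqrt 2) + C₁' * Real.exp (-(x / Real.sqrt 2)))
            * denomSol C₁ C₁' C₂ (t, x)
          + 2 * (C₁ * Real.exp (x / Real.sqrt 2) - C₁' * Real.exp (-(x / Real.sqrt 2))) ^ 2)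
        / (2 * denomSol C₁ C₁' C₂ (t, x) ^ 3) := by
  have hD := hasDerivAt_denomSol_snd C₁ C₁' C₂ t x
  have hN := hasDerivAt_exp_sub_exp_neg C₁ C₁' (Real.sqrt 2) x
  have hS := hasDerivAt_exp_add_exp_neg C₁ C₁' (Real.sqrt 2) x
  have hev : (fun y => dx (vSol C₁ C₁' C₂) (t, y)) =ᶠ[nhds x] _ :=
    (hD.continuousAt.eventually_ne h).mono fun y hy => dx_vSol C₁ C₁' C₂ t y hy
  have hq := (((hS.mul hD).sub (hN.pow 2)).div (hD.pow 2) (pow_ne_zero 2 h)).div_const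
    (Real.sqrt 2)
  refine (hev.deriv_eq.trans hq.deriv).trans ?_
  have h2 : Real.sqrt 2 ^ 2 = 2 := Real.sq_sqrt zero_le_two
  have h0 : Real.sqrt 2 ≠ 0 := by positivity
  simp only [Pi.mul_apply, Pi.sub_apply, Pi.pow_apply]
  generalize C₁ * Real.exp (x / Real.sqrt 2) - C₁' * Real.exp (-(x / Real.sqrt 2)) = N
  generalize C₁ * Real.exp (x / Real.sqrt 2) + C₁' * Real.exp (-(x / Real.sqrt 2)) = S
  generalize denomSol C₁ C₁' C₂ (t, x) = D at h ⊢
  field_simp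
  rw [h2]
  ring

/-- `v` is an exact solution of `v_t = v_xx - v³ + v` wherever the denominator is
nonzero. -/
theorem exact_solution_cubic_source_with_linear_term (C₁ C₁' C₂ : ℝ) :
    ∀ p : ℝ × ℝ, denomSol C₁ C₁' C₂ p ≠ 0 →
      dt (vSol C₁ C₁' C₂) p
        = dx (dx (vSol C₁ C₁' C₂)) p - vSol C₁ C₁' C₂ p ^ 3 + vSol C₁ C₁' C₂ p := by
  rintro ⟨t, x⟩ h
  rw [dt_vSol C₁ C₁' C₂ t x h, dx_dx_vSol C₁ C₁' C₂ t x h]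
  have hT : C₂ * Real.exp (-(3 * t / 2)) = denomSol C₁ C₁' C₂ (t, x)
      - (C₁ * Real.exp (x / Real.sqrt 2) + C₁' * Real.exp (-(x / Real.sqrt 2))) := by
    simp only [denomSol]
    ring
  rw [hT, vSol]
  field_simp
  ring
end

section
/- The function u(t, x) = -√2·(√(1 + 3t x²) + 1) / (x²·√(1 + 3t x²)) is an exact solution of the nonlinear diffusion–convection equation u_t = ((u^{-1})_x - x³·u)_x at every point (t, x) with x ≠ 0 and 1 + 3t x² > 0. -/
/-- The function `u(t, x) = -√2 (√(1 + 3tx²) + 1) / (x² √(1 + 3tx²))`. -/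
noncomputable def uSol (p : ℝ × ℝ) : ℝ :=
  -Real.sqrt 2 * (Real.sqrt (1 + 3 * p.1 * p.2 ^ 2) + 1)
    / (p.2 ^ 2 * Real.sqrt (1 + 3 * p.1 * p.2 ^ 2))

theorem hasDerivAt_sqrt_one_add_time {t x : ℝ} (hw : 0 < 1 + 3 * t * x ^ 2) :
    HasDerivAt (fun s => Real.sqrt (1 + 3 * s * x ^ 2))
      (3 * x ^ 2 / (2 * Real.sqrt (1 + 3 * t * x ^ 2))) t := by
  have h : HasDerivAt (fun s : ℝ => 1 + 3 * s * x ^ 2) (3 * x ^ 2) t := by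
    simpa using (((hasDerivAt_id t).const_mul 3).mul_const (x ^ 2)).const_add 1
  exact h.sqrt hw.ne'

theorem hasDerivAt_sqrt_one_add_space {t x : ℝ} (hw : 0 < 1 + 3 * t * x ^ 2) :
    HasDerivAt (fun y => Real.sqrt (1 + 3 * t * y ^ 2))
      (3 * t * x / Real.sqrt (1 + 3 * t * x ^ 2)) x := by
  have h : HasDerivAt (fun y : ℝ => 1 + 3 * t * y ^ 2) (3 * t * (2 * x)) x := by
    simpa using ((hasDerivAt_pow 2 x).const_mul (3 * t)).const_add 1
  convert h.sqrt hw.ne' using 1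
  have := Real.sqrt_pos.2 hw
  field_simp

theorem hasDerivAt_uSol_time {t x : ℝ} (hx : x ≠ 0) (hw : 0 < 1 + 3 * t * x ^ 2) :
    HasDerivAt (fun s => uSol (s, x))
      (3 * Real.sqrt 2 / (2 * Real.sqrt (1 + 3 * t * x ^ 2) ^ 3)) t := by
  have h := hasDerivAt_sqrt_one_add_time hw
  have hpos := Real.sqrt_pos.2 hw
  have H := ((h.add_const 1).const_mul (-Real.sqrt 2)).fun_div (h.const_mul (x ^ 2))
    (by positivity)
  refine H.congr_deriv ?_
  generalize Real.sqrt (1 + 3 * t * x ^ 2) = w at *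
  field_simp
  ring

theorem hasDerivAt_inv_uSol_space {t x : ℝ} (hx : x ≠ 0) (hw : 0 < 1 + 3 * t * x ^ 2) :
    HasDerivAt (fun y => (uSol (t, y))⁻¹)
      (-(2 * x - x / Real.sqrt (1 + 3 * t * x ^ 2)) / Real.sqrt 2) x := by
  have h := hasDerivAt_sqrt_one_add_space hw
  have hpos := Real.sqrt_pos.2 hw
  have hsq := Real.sq_sqrt hw.le
  have h2 : Real.sqrt 2 ≠ 0 := by positivity
  have hne : Real.sqrt (1 + 3 * t * x ^ 2) + 1 ≠ 0 := by positivity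
  have H := ((hasDerivAt_pow 2 x).fun_mul h).fun_div ((h.add_const 1).const_mul (-Real.sqrt 2))
    (mul_ne_zero (neg_ne_zero.2 h2) hne)
  simp only [uSol, inv_div]
  refine H.congr_deriv ?_
  generalize Real.sqrt (1 + 3 * t * x ^ 2) = w at *
  have ht : t = (w ^ 2 - 1) / (3 * x ^ 2) := by
    field_simp
    linarith
  subst ht
  field_simp
  ring

theorem flux_uSol {t x : ℝ} (hx : x ≠ 0) (hw : 0 < 1 + 3 * t * x ^ 2) :
    dx (fun r => (uSol r)⁻¹) (t, x) - x ^ 3 * uSol (t, x)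
      = 3 / Real.sqrt 2 * (x / Real.sqrt (1 + 3 * t * x ^ 2)) := by
  rw [dx, (hasDerivAt_inv_uSol_space hx hw).deriv, uSol]
  have hpos := Real.sqrt_pos.2 hw
  have h2 : Real.sqrt 2 ^ 2 = 2 := Real.sq_sqrt zero_le_two
  have h20 : Real.sqrt 2 ≠ 0 := by positivity
  generalize Real.sqrt (1 + 3 * t * x ^ 2) = w at *
  simp only
  field_simp
  rw [h2]
  ring

/-- `u(t, x) = -√2 (√(1 + 3tx²) + 1) / (x² √(1 + 3tx²))` is an exact solution of
`u_t = ((u⁻¹)_x - x³ u)_x` wherever `x ≠ 0` and `1 + 3tx² > 0`. -/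
theorem exact_solution_diffusion_convection :
    ∀ p : ℝ × ℝ, p.2 ≠ 0 → 0 < 1 + 3 * p.1 * p.2 ^ 2 →
      dt uSol p
        = dx (fun q => dx (fun r => (uSol r)⁻¹) q - q.2 ^ 3 * uSol q) p := by
  rintro ⟨t, x⟩ hx hw
  simp only at hx hw
  have hev : (fun y => dx (fun r => (uSol r)⁻¹) (t, y) - y ^ 3 * uSol (t, y)) =ᶠ[nhds x]
      fun y => 3 / Real.sqrt 2 * (y / Real.sqrt (1 + 3 * t * y ^ 2)) := by
    have hcont : Continuous fun y : ℝ => 1 + 3 * t * y ^ 2 := by fun_prop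
    filter_upwards [eventually_ne_nhds hx, hcont.continuousAt.eventually (lt_mem_nhds hw)]
      with y hy hyw using flux_uSol hy hyw
  have hpos := Real.sqrt_pos.2 hw
  have hsq := Real.sq_sqrt hw.le
  have h2 : Real.sqrt 2 ^ 2 = 2 := Real.sq_sqrt zero_le_two
  have h20 : Real.sqrt 2 ≠ 0 := by positivity
  have H := ((hasDerivAt_id' x).fun_div (hasDerivAt_sqrt_one_add_space hw) hpos.ne').const_mul
    (3 / Real.sqrt 2)
  rw [dt, dx, (hasDerivAt_uSol_time hx hw).deriv, hev.deriv_eq, H.deriv]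
  generalize Real.sqrt (1 + 3 * t * x ^ 2) = w at *
  field_simp
  rw [h2, hsq]
  ring
end
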